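/- arXiv:1612.00515 — 2 statements merged into one kernel-verified Lean document; each statement's English description precedes it below -/
import Mathlib

section
/- Let f(x) = (x+e)/log(x+e), fix L ∈ (1,∞), and set x(t) = exp(√(2L(t+1))) − e for t ≥ 0. With H defined from x by the Volterra identity for the kernel e^{−s}, the following hold: (i) H(t)/( ((L−1)/L)·exp(√(2L(t+1))) ) → 1 as t → ∞; (ii) H(t)/∫₀ᵗ f(H(s)) ds → L as t → ∞ (so L_f(H) = L); and (iii) x(t)/H(t) → L/(L−1) as t → ∞, attaining the upper bound of Theorem 3.6(a). -/
open Filter MeasureTheory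

lemma aux_littleo (k g : ℝ → ℝ) (hk : ∀ t, 0 ≤ t → IntervalIntegrable k volume 0 t)
    (hg : ∀ t, 0 ≤ t → IntervalIntegrable g volume 0 t) (gpos : ∀ s, 0 ≤ s → 0 < g s)
    (ho : Tendsto (fun t => k t / g t) atTop (nhds 0))
    (hG : Tendsto (fun t => ∫ s in (0:ℝ)..t, g s) atTop atTop) :
    Tendsto (fun t => (∫ s in (0:ℝ)..t, k s) / ∫ s in (0:ℝ)..t, g s) atTop (nhds 0) := by
  rw [Metric.tendsto_atTop]
  intro ε hε
  rw [Metric.tendsto_atTop] at ho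
  obtain ⟨T0, hT0⟩ := ho (ε / 2) (by positivity)
  set T := max T0 0 with hT
  have hTn : 0 ≤ T := le_max_right _ _
  have hb : ∀ s, T ≤ s → |k s| ≤ ε / 2 * g s := by
    intro s hs
    have h1 := hT0 s (le_trans (le_max_left _ _) hs)
    have h2 := gpos s (hTn.trans hs)
    rw [Real.dist_eq, sub_zero, abs_div, abs_of_pos h2, div_lt_iff₀ h2] at h1
    exact h1.le
  set C := |∫ s in (0:ℝ)..T, k s| with hC
  obtain ⟨N, hN⟩ := (hG.eventually (eventually_gt_atTop (2 * C / ε))).exists_forall_of_atTop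
  refine ⟨max N T, fun t ht => ?_⟩
  have htT : T ≤ t := le_trans (le_max_right _ _) ht
  have ht0 : 0 ≤ t := hTn.trans htT
  have hGt := hN t (le_trans (le_max_left _ _) ht)
  have hGpos : 0 < ∫ s in (0:ℝ)..t, g s := lt_of_le_of_lt (by positivity) hGt
  have ik : IntervalIntegrable k volume T t := (hk T hTn).symm.trans (hk t ht0)
  have ig : IntervalIntegrable g volume T t := (hg T hTn).symm.trans (hg t ht0)
  have e1 := intervalIntegral.integral_add_adjacent_intervals (hk T hTn) ik
  have e2 := intervalIntegral.integral_add_adjacent_intervals (hg T hTn) ig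
  have b1 : |∫ s in T..t, k s| ≤ ∫ s in T..t, ε / 2 * g s :=
    (intervalIntegral.abs_integral_le_integral_abs htT).trans
      (intervalIntegral.integral_mono_on htT ik.abs (ig.const_mul _) (fun s hs => hb s hs.1))
  rw [intervalIntegral.integral_const_mul] at b1
  have b2 : 0 ≤ ∫ s in (0:ℝ)..T, g s :=
    intervalIntegral.integral_nonneg hTn (fun s hs => (gpos s hs.1).le)
  rw [Real.dist_eq, sub_zero, abs_div, abs_of_pos hGpos, div_lt_iff₀ hGpos, ← e1]
  have b3 := abs_add_le (∫ s in (0:ℝ)..T, k s) (∫ s in T..t, k s)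
  rw [div_lt_iff₀ hε] at hGt
  nlinarith

lemma exp_div_mono {a b : ℝ} (ha : 1 ≤ a) (hab : a ≤ b) :
    Real.exp a / a ≤ Real.exp b / b := by
  have ha0 : 0 < a := by linarith
  have hb0 : 0 < b := by linarith
  rw [div_le_div_iff₀ ha0 hb0]
  have h : b / a ≤ Real.exp (b - a) := by
    have h1 := Real.add_one_le_exp (b - a)
    have : b / a ≤ b - a + 1 := by
      rw [div_le_iff₀ ha0]; nlinarith
    linarith
  have h2 : Real.exp b = Real.exp a * Real.exp (b - a) := by
    rw [← Real.exp_add]; ring_nf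
  rw [h2]
  rw [div_le_iff₀ ha0] at h
  nlinarith [Real.exp_pos a]

/-- For `f(x) = (x+e)/log(x+e)`, `L ∈ (1,∞)`,
`x(t) = exp(√(2L(t+1))) − e`, with `H` defined from `x` by the Volterra identity for the
kernel `e^{−s}`: (i) `H(t) ∼ ((L−1)/L)·exp(√(2L(t+1)))`; (ii) `H(t)/∫₀ᵗ f(H(s)) ds → L`
(so `L_f(H) = L`); and (iii) `x(t)/H(t) → L/(L−1)`, attaining the upper bound of
Theorem 3.6(a). -/
theorem stmt17 (L : ℝ) (hL : 1 < L) :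
    let f : ℝ → ℝ := fun u => (u + Real.exp 1) / Real.log (u + Real.exp 1)
    let x : ℝ → ℝ := fun t => Real.exp (Real.sqrt (2 * L * (t + 1))) - Real.exp 1
    let H : ℝ → ℝ := fun t => x t - x 0 - (∫ s in (0:ℝ)..t, f (x s))
        + ∫ s in (0:ℝ)..t, Real.exp (-(t - s)) * f (x s)
    Tendsto (fun t => H t / (((L - 1) / L) * Real.exp (Real.sqrt (2 * L * (t + 1)))))
      atTop (nhds 1) ∧
    Tendsto (fun t => H t / ∫ s in (0:ℝ)..t, f (H s)) atTop (nhds L) ∧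
    Tendsto (fun t => x t / H t) atTop (nhds (L / (L - 1))) := by
  intro f x H
  set r : ℝ → ℝ := fun t => Real.sqrt (2 * L * (t + 1)) with hr
  set E : ℝ → ℝ := fun t => Real.exp (r t) with hE
  set g : ℝ → ℝ := fun t => E t / r t with hg
  set J : ℝ → ℝ := fun t => ∫ s in (0:ℝ)..t, Real.exp (-(t - s)) * g s with hJ
  set c : ℝ := (L - 1) / L with hc
  have hL0 : 0 < L := by linarith
  have hcpos : 0 < c := div_pos (by linarith) hL0
  have hfx : ∀ s, f (x s) = g s := by
    intro s
    simp [f, x, g, E, r]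
  have Epos : ∀ t, 0 < E t := fun t => Real.exp_pos _
  have r1 : ∀ t, 0 ≤ t → 1 ≤ r t := by
    intro t ht
    apply Real.one_le_sqrt.mpr
    nlinarith
  have rmono : Monotone r := by
    intro a b hab
    apply Real.sqrt_le_sqrt
    nlinarith
  have gpos : ∀ t, 0 ≤ t → 0 < g t := fun t ht => div_pos (Epos t) (by linarith [r1 t ht])
  have rcont : Continuous r := by fun_prop
  have Econt : Continuous E := by fun_prop
  have gcont : ContinuousOn g (Set.Ici 0) :=
    Econt.continuousOn.div rcont.continuousOn (fun t ht => by linarith [r1 t ht])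
  have cII : ∀ (k : ℝ → ℝ), ContinuousOn k (Set.Ici 0) →
      ∀ t, 0 ≤ t → IntervalIntegrable k volume 0 t := by
    intro k hk t ht
    apply ContinuousOn.intervalIntegrable
    rw [Set.uIcc_of_le ht]
    exact hk.mono Set.Icc_subset_Ici_self
  have gint := cII g gcont
  have rtop : Tendsto r atTop atTop := by
    apply Real.tendsto_sqrt_atTop.comp
    exact (tendsto_atTop_add_const_right _ _ tendsto_id).const_mul_atTop (by positivity)
  have Etop : Tendsto E atTop atTop := Real.tendsto_exp_atTop.comp rtop
  have hEd : ∀ t, 0 ≤ t → HasDerivAt E (L * g t) t := by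
    intro t ht
    have h1 : HasDerivAt (fun t : ℝ => 2 * L * (t + 1)) (2 * L * 1) t :=
      ((hasDerivAt_id t).add_const 1).const_mul (2 * L)
    have h2 : (2 * L * (t + 1)) ≠ 0 := by positivity
    have h3 := (h1.sqrt h2).exp
    convert h3 using 1
    have : r t ≠ 0 := by linarith [r1 t ht]
    change L * (E t / r t) = E t * (2 * L * 1 / (2 * r t))
    field_simp
  have hGint : ∀ t, 0 ≤ t → ∫ s in (0:ℝ)..t, g s = (E t - E 0) / L := by
    intro t ht
    have := intervalIntegral.integral_eq_sub_of_hasDerivAt (f := E) (f' := fun s => L * g s)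
      (a := 0) (b := t) (fun s hs => by
        rw [Set.uIcc_of_le ht] at hs; exact hEd s hs.1) ((gint t ht).const_mul L)
    rw [intervalIntegral.integral_const_mul] at this
    rw [← this]; field_simp
  have hHJ : ∀ t, 0 ≤ t → H t = c * (E t - E 0) + J t := by
    intro t ht
    simp only [H, hfx]
    rw [hGint t ht]
    simp only [x, hJ, hc]
    change E t - _ - (E 0 - _) - _ + _ = _
    field_simp
    ring
  have J0 : ∀ t, 0 ≤ t → 0 ≤ J t := by
    intro t ht
    apply intervalIntegral.integral_nonneg ht
    intro s hs
    exact mul_nonneg (Real.exp_pos _).le (gpos s hs.1).le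
  have J1 : ∀ t, 0 ≤ t → J t ≤ g t := by
    intro t ht
    have h1 : J t ≤ ∫ s in (0:ℝ)..t, Real.exp (-(t - s)) * g t := by
      apply intervalIntegral.integral_mono_on ht
      · exact cII _ ((by fun_prop : Continuous fun s => Real.exp (-(t - s))).continuousOn.mul gcont)
          t ht
      · exact (by fun_prop : Continuous fun s => Real.exp (-(t - s)) * g t).intervalIntegrable _ _
      · intro s hs
        exact mul_le_mul_of_nonneg_left (exp_div_mono (r1 s hs.1) (rmono hs.2)) (Real.exp_pos _).le
    have h2 : ∫ s in (0:ℝ)..t, Real.exp (-(t - s)) = 1 - Real.exp (-t) := by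
      have := intervalIntegral.integral_eq_sub_of_hasDerivAt
        (f := fun s => Real.exp (-(t - s))) (f' := fun s => Real.exp (-(t - s)))
        (a := 0) (b := t) (fun s hs => by
          have := (((hasDerivAt_id s).const_sub t).neg).exp
          simpa using this)
        ((by fun_prop : Continuous fun s => Real.exp (-(t - s))).intervalIntegrable _ _)
      rw [this]; simp
    rw [intervalIntegral.integral_mul_const, h2] at h1
    nlinarith [gpos t ht, Real.exp_pos (-t)]
  have JE : Tendsto (fun t => J t / E t) atTop (nhds 0) := by
    refine squeeze_zero' ?_ ?_ rtop.inv_tendsto_atTop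
    · filter_upwards [eventually_ge_atTop 0] with t ht using div_nonneg (J0 t ht) (Epos t).le
    · filter_upwards [eventually_ge_atTop 0] with t ht
      have := J1 t ht
      rw [div_le_iff₀ (Epos t)]
      calc J t ≤ g t := this
        _ = _ := by simp [hg, div_eq_inv_mul]
  have Einv : ∀ a : ℝ, Tendsto (fun t => a / E t) atTop (nhds 0) := fun a =>
    Etop.const_div_atTop a
  have A : Tendsto (fun t => H t / E t) atTop (nhds c) := by
    have : Tendsto (fun t => c * (1 - E 0 / E t) + J t / E t) atTop (nhds (c * (1 - 0) + 0)) :=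
      ((tendsto_const_nhds.sub (Einv (E 0))).const_mul c).add JE
    rw [sub_zero, mul_one, add_zero] at this
    refine this.congr' ?_
    filter_upwards [eventually_ge_atTop 0] with t ht
    rw [hHJ t ht]
    have := (Epos t).ne'
    field_simp
  have H0 : ∀ t, 0 ≤ t → 0 ≤ H t := by
    intro t ht
    rw [hHJ t ht]
    have : E 0 ≤ E t := Real.exp_le_exp.mpr (rmono ht)
    exact add_nonneg (mul_nonneg hcpos.le (by linarith)) (J0 t ht)
  refine ⟨?_, ?_, ?_⟩
  · have := A.div_const c
    rw [div_self hcpos.ne'] at this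
    refine this.congr fun t => ?_
    rw [div_div, mul_comm]
  · -- continuity
    have Jcont : ContinuousOn J (Set.Ici 0) := by
      have h1 : ∀ t, J t = Real.exp (-t) * ∫ s in (0:ℝ)..t, Real.exp s * g s := by
        intro t
        rw [← intervalIntegral.integral_const_mul]
        refine intervalIntegral.integral_congr fun s _ => ?_
        change Real.exp (-(t - s)) * g s = Real.exp (-t) * (Real.exp s * g s)
        rw [← mul_assoc, ← Real.exp_add]; ring_nf
      have h2 : ContinuousOn (fun t => ∫ s in (0:ℝ)..t, Real.exp s * g s) (Set.Ici 0) := by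
        intro t ht
        have ht' : (0:ℝ) ≤ t := ht
        have hi := cII (fun s => Real.exp s * g s)
          (Real.continuous_exp.continuousOn.mul gcont) (t + 1) (by linarith)
        have hc1 := intervalIntegral.continuousOn_primitive_interval'
          (a := 0) hi (by simp)
        rw [Set.uIcc_of_le (by linarith)] at hc1
        refine (hc1 t ⟨ht', by linarith⟩).mono_of_mem_nhdsWithin ?_
        filter_upwards [self_mem_nhdsWithin,
          mem_nhdsWithin_of_mem_nhds (Iio_mem_nhds (show t < t + 1 by linarith))] with u hu1 hu2
        exact ⟨hu1, le_of_lt hu2⟩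
      refine ((by fun_prop : Continuous fun t : ℝ => Real.exp (-t)).continuousOn.mul h2).congr ?_
      intro t _
      exact h1 t
    have Hcont : ContinuousOn H (Set.Ici 0) := by
      refine (((Econt.sub (continuous_const (y := E 0))).const_smul c).continuousOn.add Jcont).congr ?_
      intro t ht
      exact hHJ t ht
    have e1 : ∀ t, 0 ≤ t → 1 ≤ Real.log (H t + Real.exp 1) := by
      intro t ht
      rw [Real.le_log_iff_exp_le (by linarith [H0 t ht, Real.exp_pos 1])]
      linarith [H0 t ht]
    have fHcont : ContinuousOn (fun t => f (H t)) (Set.Ici 0) := by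
      have h1 : ContinuousOn (fun t => H t + Real.exp 1) (Set.Ici 0) :=
        Hcont.add continuousOn_const
      refine h1.div (h1.log ?_) ?_
      · intro t ht
        linarith [H0 t ht, Real.exp_pos 1]
      · intro t ht
        linarith [e1 t ht]
    have B : Tendsto (fun t => (H t + Real.exp 1) / E t) atTop (nhds c) := by
      have := A.add (Einv (Real.exp 1))
      rw [add_zero] at this
      exact this.congr fun t => (add_div (H t) (Real.exp 1) (E t)).symm
    have Lg : Tendsto (fun t => Real.log (H t + Real.exp 1) / r t) atTop (nhds 1) := by
      have h1 := ((B.log hcpos.ne').div_atTop rtop).add_const 1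
      rw [zero_add] at h1
      refine h1.congr' ?_
      filter_upwards [eventually_ge_atTop 0] with t ht
      have h3 : H t + Real.exp 1 ≠ 0 := by linarith [H0 t ht, Real.exp_pos 1]
      rw [Real.log_div h3 (Epos t).ne']
      have h4 : Real.log (E t) = r t := Real.log_exp _
      have h5 : r t ≠ 0 := by linarith [r1 t ht]
      rw [h4]
      field_simp
      ring
    have Q : Tendsto (fun t => f (H t) / g t) atTop (nhds c) := by
      have h1 := B.div Lg one_ne_zero
      rw [div_one] at h1
      refine h1.congr fun t => ?_
      simp only [f, hg, Pi.div_apply]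
      rw [div_div_div_comm]
    have Q0 : Tendsto (fun t => (f (H t) - c * g t) / g t) atTop (nhds 0) := by
      have h1 := Q.sub_const c
      rw [sub_self] at h1
      refine h1.congr' ?_
      filter_upwards [eventually_ge_atTop 0] with t ht
      have := (gpos t ht).ne'
      field_simp
    have Gtop : Tendsto (fun t => ∫ s in (0:ℝ)..t, g s) atTop atTop := by
      have : Tendsto (fun t => (E t - E 0) / L) atTop atTop :=
        (tendsto_atTop_add_const_right _ (-E 0) Etop).atTop_div_const hL0
      refine this.congr' ?_
      filter_upwards [eventually_ge_atTop 0] with t ht using (hGint t ht).symm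
    have fHint := cII _ fHcont
    have I0 := aux_littleo (fun t => f (H t) - c * g t) g
      (fun t ht => (fHint t ht).sub ((gint t ht).const_mul c)) gint gpos Q0 Gtop
    have I1 : Tendsto (fun t => (∫ s in (0:ℝ)..t, f (H s)) / ∫ s in (0:ℝ)..t, g s) atTop
        (nhds c) := by
      have h1 := I0.add_const c
      rw [zero_add] at h1
      refine h1.congr' ?_
      filter_upwards [eventually_ge_atTop 0, Gtop.eventually (eventually_gt_atTop 0)] with t ht hp
      rw [intervalIntegral.integral_sub (fHint t ht) ((gint t ht).const_mul c),
        intervalIntegral.integral_const_mul]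
      field_simp
      ring
    have I2 : Tendsto (fun t => (∫ s in (0:ℝ)..t, g s) / E t) atTop (nhds (1 / L)) := by
      have h1 : Tendsto (fun t => (1 - E 0 / E t) / L) atTop (nhds ((1 - 0) / L)) :=
        (tendsto_const_nhds.sub (Einv (E 0))).div_const L
      rw [sub_zero] at h1
      refine h1.congr' ?_
      filter_upwards [eventually_ge_atTop 0] with t ht
      rw [hGint t ht]
      have := (Epos t).ne'
      field_simp
    have I3 := A.div (I1.mul I2) (by positivity)
    have : c / (c * (1 / L)) = L := by field_simp
    rw [this] at I3
    refine I3.congr' ?_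
    filter_upwards [Gtop.eventually (eventually_gt_atTop 0)] with t hp
    have h1 := (Epos t).ne'
    simp only [Pi.div_apply]
    rw [div_mul_div_cancel₀ hp.ne', div_div_div_cancel_right₀ h1]
  · have h1 : Tendsto (fun t => (1 - Real.exp 1 / E t) / (H t / E t)) atTop (nhds ((1 - 0) / c)) :=
      (tendsto_const_nhds.sub (Einv (Real.exp 1))).div A hcpos.ne'
    have : (1 - 0) / c = L / (L - 1) := by
      rw [hc, sub_zero, one_div_div]
    rw [this] at h1
    refine h1.congr fun t => ?_
    have h1 := (Epos t).ne'
    rw [one_sub_div h1, div_div_div_cancel_right₀ h1]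
end

section
/- Let f(x) = (x+e)/log(x+e), fix α ∈ (1/2,1), and set x(t) = exp((2(t+1))^α) − e for t ≥ 0. With H defined from x by the Volterra identity for the kernel e^{−s}, the following hold: (i) x(t)/H(t) → 1 as t → ∞; and (ii) H(t)/∫₀ᵗ f(H(s)) ds → ∞ as t → ∞ (so L_f(H) = ∞). -/
open Filter MeasureTheory

lemma aux_int {g : ℝ → ℝ} (hg : ContinuousOn g (Set.Ici 0)) {a b : ℝ} (ha : 0 ≤ a) (hb : 0 ≤ b) :
    IntervalIntegrable g volume a b := by
  apply ContinuousOn.intervalIntegrable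
  apply hg.mono
  intro s hs
  exact le_trans (le_min ha hb) hs.1

lemma aux_E {E g k : ℝ → ℝ} (hE : ∀ t, 0 ≤ t → HasDerivAt E (k t * g t) t)
    (hg : ContinuousOn g (Set.Ici 0)) (hk : ContinuousOn k (Set.Ici 0))
    (hg0 : ∀ t, 0 ≤ t → 0 < g t) {a t c : ℝ} (ha : 0 ≤ a) (hat : a ≤ t)
    (hc : ∀ s, a ≤ s → c ≤ k s) :
    c * (∫ s in a..t, g s) ≤ E t - E a := by
  have ht : 0 ≤ t := ha.trans hat
  have h1 : ∫ s in a..t, k s * g s = E t - E a := by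
    apply intervalIntegral.integral_eq_sub_of_hasDerivAt
    · intro s hs
      exact hE s (le_trans (le_min ha ht) hs.1)
    · exact aux_int (hk.mul hg) ha ht
  rw [← h1, ← intervalIntegral.integral_const_mul]
  apply intervalIntegral.integral_mono_on hat
  · exact (aux_int hg ha ht).const_mul c
  · exact aux_int (hk.mul hg) ha ht
  · intro s hs
    exact mul_le_mul_of_nonneg_right (hc s hs.1) (hg0 s (ha.trans hs.1)).le

lemma aux_lim {E g k : ℝ → ℝ} (hE : ∀ t, 0 ≤ t → HasDerivAt E (k t * g t) t)
    (hg : ContinuousOn g (Set.Ici 0)) (hk : ContinuousOn k (Set.Ici 0))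
    (hg0 : ∀ t, 0 ≤ t → 0 < g t) (hE0 : ∀ t, 0 < E t)
    (hkT : Tendsto k atTop atTop) (hET : Tendsto E atTop atTop) :
    Tendsto (fun t => (∫ s in (0:ℝ)..t, g s) / E t) atTop (nhds 0) := by
  rw [Metric.tendsto_atTop]
  intro ε hε
  obtain ⟨T, hT⟩ := eventually_atTop.1 (hkT.eventually_ge_atTop (2 / ε))
  set a := max T 0 with ha
  have ha0 : 0 ≤ a := le_max_right _ _
  obtain ⟨T', hT'⟩ := eventually_atTop.1
    (hET.eventually_gt_atTop (2 / ε * (∫ s in (0:ℝ)..a, g s)))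
  refine ⟨max a T', fun t ht => ?_⟩
  have hat : a ≤ t := le_trans (le_max_left _ _) ht
  have h1 := hT' t (le_trans (le_max_right _ _) ht)
  have h2 := aux_E hE hg hk hg0 ha0 hat (c := 2 / ε)
    (fun s hs => hT s (le_trans (le_max_left _ _) hs))
  have h3 := intervalIntegral.integral_add_adjacent_intervals (aux_int hg le_rfl ha0)
    (aux_int hg ha0 (ha0.trans hat))
  have h4 : 0 ≤ ∫ s in (0:ℝ)..t, g s :=
    intervalIntegral.integral_nonneg (ha0.trans hat) fun s hs => (hg0 s hs.1).le
  rw [Real.dist_eq, sub_zero, abs_of_nonneg (div_nonneg h4 (hE0 t).le), div_lt_iff₀ (hE0 t)]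
  have h5 : 2 / ε * (∫ s in (0:ℝ)..t, g s) < 2 * E t := by
    rw [← h3, mul_add]; linarith [hE0 a]
  rw [div_mul_eq_mul_div, div_lt_iff₀ hε] at h5
  linarith

lemma aux_mono {u v : ℝ} (hu : 0 ≤ u) (huv : u ≤ v) :
    (u + Real.exp 1) / Real.log (u + Real.exp 1) ≤ (v + Real.exp 1) / Real.log (v + Real.exp 1) := by
  have he := Real.exp_pos 1
  have h := Real.log_div_self_antitoneOn (a := u + Real.exp 1) (b := v + Real.exp 1)
    (by simpa using hu) (by simpa using hu.trans huv) (by linarith)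
  have hv : 0 < Real.log (v + Real.exp 1) := by
    apply Real.log_pos
    have := Real.add_one_lt_exp (one_ne_zero)
    linarith
  have := inv_anti₀ (div_pos hv (by linarith)) h
  simpa [inv_div] using this

theorem aux_main {E g k : ℝ → ℝ} (hE : ∀ t, 0 ≤ t → HasDerivAt E (k t * g t) t)
    (hg : ContinuousOn g (Set.Ici 0)) (hk : ContinuousOn k (Set.Ici 0))
    (hg0 : ∀ t, 0 ≤ t → 0 < g t) (hE0 : ∀ t, 0 < E t) (hEe : Real.exp 1 ≤ E 0)
    (hk1 : ∀ t, 0 ≤ t → 1 ≤ k t)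
    (hkT : Tendsto k atTop atTop) (hET : Tendsto E atTop atTop)
    (f : ℝ → ℝ) (hf : f = fun u => (u + Real.exp 1) / Real.log (u + Real.exp 1))
    (hfg : ∀ t, f (E t - Real.exp 1) = g t) (H : ℝ → ℝ)
    (hH : H = fun t => (E t - Real.exp 1) - (E 0 - Real.exp 1) - (∫ s in (0:ℝ)..t, g s)
        + ∫ s in (0:ℝ)..t, Real.exp (-(t - s)) * g s) :
    Tendsto (fun t => (E t - Real.exp 1) / H t) atTop (nhds 1) ∧
    Tendsto (fun t => H t / ∫ s in (0:ℝ)..t, f (H s)) atTop atTop := by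
  have hlim := aux_lim hE hg hk hg0 hE0 hkT hET
  have hJ0 : ∀ t, 0 ≤ t → 0 ≤ ∫ s in (0:ℝ)..t, Real.exp (-(t - s)) * g s := fun t ht =>
    intervalIntegral.integral_nonneg ht fun s hs => mul_nonneg (Real.exp_pos _).le (hg0 s hs.1).le
  have hJ1 : ∀ t, 0 ≤ t → ∫ s in (0:ℝ)..t, Real.exp (-(t - s)) * g s ≤ ∫ s in (0:ℝ)..t, g s := by
    intro t ht
    apply intervalIntegral.integral_mono_on ht
    · refine aux_int (ContinuousOn.mul ?_ hg) le_rfl ht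
      fun_prop
    · exact aux_int hg le_rfl ht
    · intro s hs
      have : Real.exp (-(t - s)) ≤ 1 := Real.exp_le_one_iff.2 (by linarith [hs.2])
      nlinarith [hg0 s hs.1]
  have hHnn : ∀ t, 0 ≤ t → 0 ≤ H t := by
    intro t ht
    have := aux_E hE hg hk hg0 le_rfl ht hk1
    rw [hH]
    dsimp only
    linarith [hJ0 t ht]
  have hHle : ∀ t, 0 ≤ t → H t ≤ E t - Real.exp 1 := by
    intro t ht
    rw [hH]
    dsimp only
    linarith [hJ1 t ht]
  have hprim : ∀ (w : ℝ → ℝ) (t : ℝ), ContinuousOn w (Set.Ici 0) → 0 ≤ t →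
      ContinuousOn (fun t => ∫ s in (0:ℝ)..t, w s) (Set.uIcc 0 t) := by
    intro w t hw ht
    apply intervalIntegral.continuousOn_primitive_interval
    apply ContinuousOn.integrableOn_compact isCompact_uIcc
    apply hw.mono
    rw [Set.uIcc_of_le ht]
    exact Set.Icc_subset_Ici_self
  have hHc : ∀ t, 0 ≤ t → ContinuousOn H (Set.uIcc 0 t) := by
    intro t ht
    have hEq : H = fun t => (E t - Real.exp 1) - (E 0 - Real.exp 1) - (∫ s in (0:ℝ)..t, g s)
        + Real.exp (-t) * ∫ s in (0:ℝ)..t, Real.exp s * g s := by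
      rw [hH]
      funext t
      rw [← intervalIntegral.integral_const_mul]
      congr 2
      funext s
      rw [← mul_assoc, ← Real.exp_add]
      congr 2
      ring
    have hEc : ContinuousOn E (Set.uIcc 0 t) := by
      intro s hs
      rw [Set.uIcc_of_le ht] at hs
      exact (hE s hs.1).continuousAt.continuousWithinAt
    rw [hEq]
    have h1 := hprim g t hg ht
    have h2 := hprim (fun s => Real.exp s * g s) t (Real.continuous_exp.continuousOn.mul hg) ht
    have h3 : ContinuousOn (fun t : ℝ => Real.exp (-t)) (Set.uIcc 0 t) := by fun_prop
    exact (((hEc.sub continuousOn_const).sub continuousOn_const).sub h1).add (h3.mul h2)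
  have hlogpos : ∀ u, 0 ≤ u → 0 < Real.log (u + Real.exp 1) := by
    intro u hu
    apply Real.log_pos
    have := Real.add_one_lt_exp (one_ne_zero)
    linarith
  have hpos : ∀ u, 0 ≤ u → 0 < u + Real.exp 1 := fun u hu => by
    linarith [Real.exp_pos 1]
  have hfHc : ∀ t, 0 ≤ t → ContinuousOn (fun s => f (H s)) (Set.uIcc 0 t) := by
    intro t ht
    have hc : ContinuousOn (fun s => H s + Real.exp 1) (Set.uIcc 0 t) :=
      (hHc t ht).add continuousOn_const
    have hnn : ∀ s ∈ Set.uIcc 0 t, 0 ≤ H s := by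
      intro s hs
      rw [Set.uIcc_of_le ht] at hs
      exact hHnn s hs.1
    rw [hf]
    exact hc.div (hc.log fun s hs => (hpos _ (hnn s hs)).ne')
      fun s hs => (hlogpos _ (hnn s hs)).ne'
  have hIle : ∀ t, 0 ≤ t → ∫ s in (0:ℝ)..t, f (H s) ≤ ∫ s in (0:ℝ)..t, g s := by
    intro t ht
    apply intervalIntegral.integral_mono_on ht
    · exact (hfHc t ht).intervalIntegrable
    · exact aux_int hg le_rfl ht
    · intro s hs
      rw [← hfg, hf]
      exact aux_mono (hHnn s hs.1) (hHle s hs.1)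
  have hIpos : ∀ t, 0 < t → 0 < ∫ s in (0:ℝ)..t, f (H s) := by
    intro t ht
    apply intervalIntegral.intervalIntegral_pos_of_pos_on
    · exact (hfHc t ht.le).intervalIntegrable
    · intro s hs
      rw [hf]
      exact div_pos (hpos _ (hHnn s hs.1.le)) (hlogpos _ (hHnn s hs.1.le))
    · exact ht
  have hcE : ∀ c : ℝ, Tendsto (fun t => c / E t) atTop (nhds 0) := fun c => hET.const_div_atTop c
  have hr : Tendsto (fun t => (E t - H t) / E t) atTop (nhds 0) := by
    have hup : Tendsto (fun t => E 0 / E t + (∫ s in (0:ℝ)..t, g s) / E t) atTop (nhds 0) := by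
      simpa using (hcE (E 0)).add hlim
    refine tendsto_of_tendsto_of_tendsto_of_le_of_le' tendsto_const_nhds hup ?_ ?_
    · filter_upwards [eventually_ge_atTop 0] with t ht
      exact div_nonneg (by linarith [hHle t ht, Real.exp_pos 1]) (hE0 t).le
    · filter_upwards [eventually_ge_atTop 0] with t ht
      rw [← add_div]
      apply div_le_div_of_nonneg_right _ (hE0 t).le
      rw [hH]
      dsimp only
      linarith [hJ0 t ht]
  have hHE : Tendsto (fun t => H t / E t) atTop (nhds 1) := by
    have := hr.const_sub 1
    rw [sub_zero] at this
    refine this.congr fun t => ?_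
    have := (hE0 t).ne'
    field_simp
    ring
  have hxE : Tendsto (fun t => (E t - Real.exp 1) / E t) atTop (nhds 1) := by
    have := (hcE (Real.exp 1)).const_sub 1
    rw [sub_zero] at this
    refine this.congr fun t => ?_
    have := (hE0 t).ne'
    field_simp
  constructor
  · have := hxE.div hHE one_ne_zero
    rw [div_one] at this
    refine this.congr fun t => ?_
    exact div_div_div_cancel_right₀ (hE0 t).ne' _ _
  · have hinv : Tendsto (fun t => ((∫ s in (0:ℝ)..t, g s) / E t)⁻¹) atTop atTop := by
      apply Tendsto.inv_tendsto_nhdsGT_zero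
      rw [tendsto_nhdsWithin_iff]
      refine ⟨hlim, ?_⟩
      filter_upwards [eventually_gt_atTop 0] with t ht
      exact div_pos ((hIpos t ht).trans_le (hIle t ht.le)) (hE0 t)
    refine tendsto_atTop_mono' _ ?_ (hHE.pos_mul_atTop one_pos hinv)
    filter_upwards [eventually_gt_atTop 0] with t ht
    rw [inv_div, div_mul_div_cancel₀ (hE0 t).ne']
    exact div_le_div_of_nonneg_left (hHnn t ht.le) (hIpos t ht) (hIle t ht.le)

/-- For `f(x) = (x+e)/log(x+e)`, `α ∈ (1/2,1)`,
`x(t) = exp((2(t+1))^α) − e`, with `H` defined from `x` by the Volterra identity for the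
kernel `e^{−s}`: (i) `x(t)/H(t) → 1`; and (ii) `H(t)/∫₀ᵗ f(H(s)) ds → ∞`
(so `L_f(H) = ∞`). -/
theorem stmt18 (α : ℝ) (hα : α ∈ Set.Ioo (1/2 : ℝ) 1) :
    let f : ℝ → ℝ := fun u => (u + Real.exp 1) / Real.log (u + Real.exp 1)
    let x : ℝ → ℝ := fun t => Real.exp ((2 * (t + 1)) ^ α) - Real.exp 1
    let H : ℝ → ℝ := fun t => x t - x 0 - (∫ s in (0:ℝ)..t, f (x s))
        + ∫ s in (0:ℝ)..t, Real.exp (-(t - s)) * f (x s)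
    Tendsto (fun t => x t / H t) atTop (nhds 1) ∧
    Tendsto (fun t => H t / ∫ s in (0:ℝ)..t, f (H s)) atTop atTop := by
  intro f x H
  obtain ⟨h1, h2⟩ := hα
  have hα0 : 0 < α := by linarith
  have hfg : ∀ t, f (x t) = Real.exp ((2 * (t + 1)) ^ α) / (2 * (t + 1)) ^ α := by
    intro t
    simp [f, x]
  have hy : ∀ t : ℝ, 0 ≤ t → 0 < 2 * (t + 1) := fun t ht => by linarith
  have hyT : Tendsto (fun t : ℝ => 2 * (t + 1)) atTop atTop :=
    (tendsto_atTop_add_const_right _ _ tendsto_id).const_mul_atTop two_pos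
  have hφc : ∀ p : ℝ, ContinuousOn (fun t : ℝ => (2 * (t + 1)) ^ p) (Set.Ici 0) := by
    intro p
    apply ContinuousOn.rpow_const
    · fun_prop
    · intro t ht
      exact Or.inl (hy t ht).ne'
  refine aux_main (E := fun t => Real.exp ((2 * (t + 1)) ^ α))
    (g := fun t => Real.exp ((2 * (t + 1)) ^ α) / (2 * (t + 1)) ^ α)
    (k := fun t => 2 * α * (2 * (t + 1)) ^ (2 * α - 1)) ?_ ?_ ?_ ?_ ?_ ?_ ?_ ?_ ?_ f rfl hfg H ?_
  · intro t ht
    have hd : HasDerivAt (fun t : ℝ => 2 * (t + 1)) 2 t := by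
      simpa using ((hasDerivAt_id t).add_const 1).const_mul 2
    have := (hd.rpow_const (p := α) (Or.inl (hy t ht).ne')).exp
    convert this using 1
    have e : (2 * (t + 1)) ^ (2 * α - 1) = (2 * (t + 1)) ^ α * (2 * (t + 1)) ^ (α - 1) := by
      rw [← Real.rpow_add (hy t ht)]
      congr 1
      ring
    have hne := (Real.rpow_pos_of_pos (hy t ht) α).ne'
    rw [e]
    field_simp
  · exact (hφc α).rexp.div (hφc α) fun t ht => (Real.rpow_pos_of_pos (hy t ht) α).ne'
  · exact continuousOn_const.mul (hφc _)
  · intro t ht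
    exact div_pos (Real.exp_pos _) (Real.rpow_pos_of_pos (hy t ht) α)
  · intro t
    exact Real.exp_pos _
  · apply Real.exp_le_exp.2
    apply Real.one_le_rpow _ hα0.le
    norm_num
  · intro t ht
    have : 1 ≤ (2 * (t + 1)) ^ (2 * α - 1) := Real.one_le_rpow (by linarith) (by linarith)
    nlinarith
  · exact ((tendsto_rpow_atTop (by linarith)).comp hyT).const_mul_atTop (by linarith)
  · exact Real.tendsto_exp_atTop.comp ((tendsto_rpow_atTop hα0).comp hyT)
  · simp only [H, hfg]
    rfl
end
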